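/- arXiv:1310.8130 — 2 statements merged into one kernel-verified Lean document; each statement's English description precedes it below -/
import Mathlib

section
/- Cauchy correlation with a gnomonic slab: let n ≥ 1, let M ⊆ ℝ^n be a bounded symmetric convex set with nonempty interior, let v ∈ ℝ^n be a unit vector, and let ε ∈ (0, π/2]. Define W = {x ∈ ℝ^n : ⟨x,v⟩² ≤ sin²(ε)·(1+|x|²)} (the gnomonic preimage of the ε-tube around a great hypersphere through the pole). Then ν_n(M ∩ W) ≥ ν_n(M)·ν_n(W). -/
open MeasureTheory Real
open scoped RealInnerProductSpace ENNReal

/-- Density (up to constant) of the Cauchy measure on `ℝⁿ`. -/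
noncomputable def cauchyDensity (n : ℕ) (x : EuclideanSpace ℝ (Fin n)) : ℝ :=
  (1 + ‖x‖ ^ 2) ^ (-(((n : ℝ) + 1) / 2))

/-- Normalizing constant of the Cauchy measure. -/
noncomputable def cauchyConst (n : ℕ) : ℝ :=
  (∫ x : EuclideanSpace ℝ (Fin n), cauchyDensity n x)⁻¹

/-- The Cauchy measure `ν_n` on `ℝⁿ`. -/
noncomputable def cauchyMeasure (n : ℕ) : Measure (EuclideanSpace ℝ (Fin n)) :=
  volume.withDensity fun x => ENNReal.ofReal (cauchyConst n * cauchyDensity n x)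

/-- Gnomonic projection of `ℝⁿ` onto the open upper hemisphere of `Sⁿ ⊆ ℝ^{n+1}`. -/
noncomputable def gnomonic (n : ℕ) (x : EuclideanSpace ℝ (Fin n)) :
    EuclideanSpace ℝ (Fin (n + 1)) :=
  (Real.sqrt (1 + ‖x‖ ^ 2))⁻¹ •
    ((EuclideanSpace.equiv (Fin (n + 1)) ℝ).symm (Fin.snoc (fun i => x i) 1))

/-- The pole `o = e_{n+1}`. -/
noncomputable def pole (n : ℕ) : EuclideanSpace ℝ (Fin (n + 1)) :=
  EuclideanSpace.single (Fin.last n) 1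

/-- The unit sphere `Sⁿ ⊆ ℝ^{n+1}` as a set. -/
noncomputable def unitSphereSet (n : ℕ) : Set (EuclideanSpace ℝ (Fin (n + 1))) :=
  Metric.sphere 0 1

/-- The open hemisphere `Sⁿ₊` centered at the pole. -/
noncomputable def hemisphere (n : ℕ) : Set (EuclideanSpace ℝ (Fin (n + 1))) :=
  {y ∈ unitSphereSet n | 0 < ⟪y, pole n⟫}

/-- One-dimensional Brunn–Minkowski inequality. -/
theorem volume_add_le_of_add_mem {A B S : Set ℝ} (hA : MeasurableSet A) (hB : MeasurableSet B)
    (hA' : A.Nonempty) (hB' : B.Nonempty) (h : ∀ x ∈ A, ∀ y ∈ B, x + y ∈ S) :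
    volume A + volume B ≤ volume S := by
  have key : ∀ K L : Set ℝ, K ⊆ A → L ⊆ B → IsCompact K → IsCompact L → K.Nonempty →
      L.Nonempty → volume K + volume L ≤ volume S := by
    intro K L hKA hLB hK hL hK' hL'
    obtain ⟨k, hk, hkmax⟩ := hK.exists_isGreatest hK'
    obtain ⟨l, hl, hlmin⟩ := hL.exists_isLeast hL'
    have h1 : volume ((fun x => l + x) '' K) = volume K := by
      simp [Set.image_add_left]
    have h2 : volume ((fun x => k + x) '' L) = volume L := by
      simp [Set.image_add_left]
    have hd : volume (((fun x => l + x) '' K) ∩ ((fun x => k + x) '' L)) = 0 := by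
      refine measure_mono_null (t := {l + k}) ?_ (by simp)
      rintro _ ⟨⟨x, hx, rfl⟩, ⟨y, hy, hxy⟩⟩
      have := hkmax hx
      have := hlmin hy
      simp only at hxy
      simp only [Set.mem_singleton_iff]
      linarith
    have hm : MeasurableSet ((fun x => k + x) '' L) :=
      (hL.image (by fun_prop)).measurableSet
    rw [← h1, ← h2, ← measure_union_add_inter _ hm, hd, add_zero]
    refine measure_mono ?_
    rintro _ (⟨x, hx, rfl⟩ | ⟨y, hy, rfl⟩)
    · simpa [add_comm] using h x (hKA hx) l (hLB hl)
    · exact h k (hKA hk) y (hLB hy)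
  obtain ⟨a, ha⟩ := hA'
  obtain ⟨b, hb⟩ := hB'
  rw [hA.measure_eq_iSup_isCompact, hB.measure_eq_iSup_isCompact]
  simp only [iSup_and']
  refine ENNReal.biSup_add_biSup_le' ⟨{a}, by simpa using ha, isCompact_singleton⟩
    ⟨{b}, by simpa using hb, isCompact_singleton⟩ ?_
  rintro K ⟨hKA, hK⟩ L ⟨hLB, hL⟩
  refine (add_le_add (measure_mono Set.subset_union_left)
    (measure_mono Set.subset_union_left)).trans
    (key (K ∪ {a}) (L ∪ {b}) ?_ ?_ (hK.union isCompact_singleton) (hL.union isCompact_singleton)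
    (by simp) (by simp))
  · exact Set.union_subset hKA (by simpa using ha)
  · exact Set.union_subset hLB (by simpa using hb)

theorem lintegral_eq_lintegral_meas_ofReal_lt {α : Type*} [MeasurableSpace α] (μ : Measure α)
    {f : α → ℝ≥0∞} (hf : Measurable f) (hf1 : ∀ x, f x ≠ ∞) :
    ∫⁻ x, f x ∂μ = ∫⁻ s in Set.Ioi (0 : ℝ), μ {x | ENNReal.ofReal s < f x} := by
  calc ∫⁻ x, f x ∂μ = ∫⁻ x, ENNReal.ofReal (f x).toReal ∂μ := by
        simp only [ENNReal.ofReal_toReal (hf1 _)]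
    _ = ∫⁻ s in Set.Ioi (0 : ℝ), μ {x | s < (f x).toReal} :=
        lintegral_eq_lintegral_meas_lt μ (.of_forall fun _ => ENNReal.toReal_nonneg)
          hf.ennreal_toReal.aemeasurable
    _ = _ := by
        refine setLIntegral_congr_fun measurableSet_Ioi fun s hs => ?_
        simp only [ENNReal.ofReal_lt_iff_lt_toReal (le_of_lt hs) (hf1 _)]

/-- The Prékopa–Leindler inequality, as a property of a measure on a real vector space. -/
def PrekopaLeindler {G : Type*} [AddCommGroup G] [Module ℝ G] [MeasurableSpace G]
    (μ : Measure G) : Prop :=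
  ∀ a b : ℝ, 0 < a → 0 < b → a + b = 1 → ∀ f g h : G → ℝ≥0∞, Measurable f → Measurable g →
    Measurable h → (∀ x y, f x ^ a * g y ^ b ≤ h (a • x + b • y)) →
    (∫⁻ x, f x ∂μ) ^ a * (∫⁻ x, g x ∂μ) ^ b ≤ ∫⁻ x, h x ∂μ

theorem ENNReal.rpow_mul_rpow_le_add (a b : ℝ) (ha : 0 < a) (hb : 0 < b) (hab : a + b = 1)
    (x y : ℝ≥0∞) : x ^ a * y ^ b ≤ ENNReal.ofReal a * x + ENNReal.ofReal b * y := by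
  have hpq : (a⁻¹).HolderConjugate b⁻¹ :=
    Real.holderConjugate_iff.2 ⟨(one_lt_inv₀ ha).2 (by linarith), by simpa using hab⟩
  refine (ENNReal.young_inequality (x ^ a) (y ^ b) hpq).trans_eq ?_
  rw [← ENNReal.rpow_mul, ← ENNReal.rpow_mul, mul_inv_cancel₀ ha.ne', mul_inv_cancel₀ hb.ne',
    ENNReal.rpow_one, ENNReal.rpow_one, div_eq_mul_inv, div_eq_mul_inv,
    ENNReal.ofReal_inv_of_pos ha, ENNReal.ofReal_inv_of_pos hb, inv_inv, inv_inv, mul_comm,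
    mul_comm y]

open scoped Pointwise in
theorem lintegral_add_le_of_sup_eq_one {a b : ℝ} (ha : 0 < a) (hb : 0 < b) (hab : a + b = 1)
    {f g h : ℝ → ℝ≥0∞} (hf : Measurable f) (hg : Measurable g) (hh : Measurable h)
    (hfs : ⨆ x, f x = 1) (hgs : ⨆ x, g x = 1)
    (H : ∀ x y, f x ^ a * g y ^ b ≤ h (a • x + b • y)) :
    ENNReal.ofReal a * (∫⁻ x, f x) + ENNReal.ofReal b * (∫⁻ x, g x) ≤ ∫⁻ x, h x := by
  have hf1 : ∀ x, f x ≤ 1 := fun x => hfs ▸ le_iSup f x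
  have hg1 : ∀ x, g x ≤ 1 := fun x => hgs ▸ le_iSup g x
  have hmeas : ∀ f : ℝ → ℝ≥0∞, Measurable fun s : ℝ => volume {x | ENNReal.ofReal s < f x} :=
    fun f => Antitone.measurable fun s t hst => measure_mono fun x hx =>
      (ENNReal.ofReal_le_ofReal hst).trans_lt hx
  have hmin : Measurable fun x => min (h x) 1 := hh.min measurable_const
  refine le_trans ?_ (lintegral_mono fun x => min_le_left (h x) 1)
  rw [lintegral_eq_lintegral_meas_ofReal_lt _ hf fun x => ne_top_of_le_ne_top (by simp) (hf1 x),
    lintegral_eq_lintegral_meas_ofReal_lt _ hg fun x => ne_top_of_le_ne_top (by simp) (hg1 x),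
    lintegral_eq_lintegral_meas_ofReal_lt _ hmin fun x =>
      ne_top_of_le_ne_top (by simp) (min_le_right (h x) 1),
    ← lintegral_const_mul _ (hmeas f), ← lintegral_const_mul _ (hmeas g),
    ← lintegral_add_left ((hmeas f).const_mul _)]
  refine setLIntegral_mono (hmeas _) fun s hs => ?_
  rcases le_or_gt 1 (ENNReal.ofReal s) with h1 | h1
  · have e1 : {x | ENNReal.ofReal s < f x} = ∅ :=
      Set.eq_empty_of_forall_notMem fun x hx => (hx.trans_le ((hf1 x).trans h1)).false
    have e2 : {x | ENNReal.ofReal s < g x} = ∅ :=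
      Set.eq_empty_of_forall_notMem fun x hx => (hx.trans_le ((hg1 x).trans h1)).false
    simp [e1, e2]
  have hsm : ∀ (c : ℝ), 0 < c → ∀ T : Set ℝ, ENNReal.ofReal c * volume T = volume (c • T) := by
    intro c hc T
    rw [Measure.addHaar_smul]
    simp [abs_of_pos hc]
  rw [hsm a ha, hsm b hb]
  obtain ⟨x0, hx0⟩ := lt_iSup_iff.1 (h1.trans_eq hfs.symm)
  obtain ⟨y0, hy0⟩ := lt_iSup_iff.1 (h1.trans_eq hgs.symm)
  refine volume_add_le_of_add_mem
    ((measurableSet_lt measurable_const hf).const_smul₀ a)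
    ((measurableSet_lt measurable_const hg).const_smul₀ b)
    (Set.Nonempty.smul_set ⟨x0, hx0⟩) (Set.Nonempty.smul_set ⟨y0, hy0⟩) ?_
  rintro _ ⟨x, hx, rfl⟩ _ ⟨y, hy, rfl⟩
  simp only [Set.mem_ofPred_eq] at hx hy ⊢
  refine lt_min (lt_of_lt_of_le ?_ (H x y)) h1
  calc ENNReal.ofReal s = ENNReal.ofReal s ^ a * ENNReal.ofReal s ^ b := by
        rw [← ENNReal.rpow_add_of_nonneg _ _ ha.le hb.le, hab, ENNReal.rpow_one]
    _ < _ := ENNReal.mul_lt_mul (ENNReal.rpow_lt_rpow hx ha) (ENNReal.rpow_lt_rpow hy hb)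

theorem prekopaLeindler_real_of_bdd {a b : ℝ} (ha : 0 < a) (hb : 0 < b) (hab : a + b = 1)
    {f g h : ℝ → ℝ≥0∞} (hf : Measurable f) (hg : Measurable g) (hh : Measurable h)
    (hfs : ⨆ x, f x ≠ ∞) (hgs : ⨆ x, g x ≠ ∞)
    (H : ∀ x y, f x ^ a * g y ^ b ≤ h (a • x + b • y)) :
    (∫⁻ x, f x) ^ a * (∫⁻ x, g x) ^ b ≤ ∫⁻ x, h x := by
  set A := ⨆ x, f x with hA
  set B := ⨆ x, g x with hB
  rcases eq_or_ne A 0 with hA0 | hA0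
  · have : ∀ x, f x = 0 := fun x => le_antisymm (hA0 ▸ le_iSup f x) zero_le
    simp [this, ha]
  rcases eq_or_ne B 0 with hB0 | hB0
  · have : ∀ x, g x = 0 := fun x => le_antisymm (hB0 ▸ le_iSup g x) zero_le
    simp [this, hb]
  have hAa0 : A ^ a ≠ 0 := by simp [hA0, hfs]
  have hBb0 : B ^ b ≠ 0 := by simp [hB0, hgs]
  have hAat : A ^ a ≠ ∞ := ENNReal.rpow_ne_top_of_nonneg ha.le hfs
  have hBbt : B ^ b ≠ ∞ := ENNReal.rpow_ne_top_of_nonneg hb.le hgs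
  have key := lintegral_add_le_of_sup_eq_one ha hb hab (f := fun x => A⁻¹ * f x)
    (g := fun x => B⁻¹ * g x) (h := fun x => (A ^ a * B ^ b)⁻¹ * h x)
    (hf.const_mul _) (hg.const_mul _) (hh.const_mul _)
    (by rw [← ENNReal.mul_iSup, ← hA, ENNReal.inv_mul_cancel hA0 hfs])
    (by rw [← ENNReal.mul_iSup, ← hB, ENNReal.inv_mul_cancel hB0 hgs])
    (by
      intro x y
      rw [ENNReal.mul_rpow_of_nonneg _ _ ha.le, ENNReal.mul_rpow_of_nonneg _ _ hb.le,
        ENNReal.inv_rpow, ENNReal.inv_rpow, ENNReal.mul_inv (.inl hAa0) (.inl hAat),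
        mul_mul_mul_comm]
      gcongr
      exact H x y)
  rw [lintegral_const_mul _ hf, lintegral_const_mul _ hg, lintegral_const_mul _ hh] at key
  have := (ENNReal.rpow_mul_rpow_le_add a b ha hb hab _ _).trans key
  rw [ENNReal.mul_rpow_of_nonneg _ _ ha.le, ENNReal.mul_rpow_of_nonneg _ _ hb.le,
        ENNReal.inv_rpow, ENNReal.inv_rpow, mul_mul_mul_comm,
        ← ENNReal.mul_inv (.inl hAa0) (.inl hAat)] at this
  exact (ENNReal.mul_le_mul_iff_right (ENNReal.inv_ne_zero.2 (ENNReal.mul_ne_top hAat hBbt))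
    (ENNReal.inv_ne_top.2 (mul_ne_zero hAa0 hBb0))).1 this

theorem prekopaLeindler_real : PrekopaLeindler (volume : Measure ℝ) := by
  intro a b ha hb hab f g h hf hg hh H
  have hb' : ∀ (f : ℝ → ℝ≥0∞) (k : ℕ), ⨆ x, min (f x) k ≠ ∞ := fun f k =>
    ne_top_of_le_ne_top (ENNReal.natCast_ne_top k) (iSup_le fun x => min_le_right _ _)
  have hsup : ∀ f : ℝ → ℝ≥0∞, Measurable f → ∫⁻ x, f x = ⨆ k : ℕ, ∫⁻ x, min (f x) k := by
    intro f hf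
    rw [← lintegral_iSup (fun k => hf.min measurable_const)]
    · refine lintegral_congr fun x => ?_
      rw [← inf_iSup_eq, ENNReal.iSup_natCast, inf_top_eq]
    · intro i j hij x
      exact min_le_min le_rfl (by exact_mod_cast hij)
  have hmono : ∀ f : ℝ → ℝ≥0∞, Monotone fun k : ℕ => ∫⁻ x, min (f x) (k : ℝ≥0∞) := fun f i j hij =>
    lintegral_mono fun x => min_le_min le_rfl (by exact_mod_cast hij)
  have hrp : ∀ (c : ℝ), 0 < c → ∀ u : ℕ → ℝ≥0∞, (⨆ k, u k) ^ c = ⨆ k, u k ^ c := fun c hc u =>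
    (ENNReal.orderIsoRpow c hc).map_iSup u
  rw [hsup f hf, hsup g hg, hrp a ha, hrp b hb, ENNReal.iSup_mul]
  refine iSup_le fun i => ?_
  rw [ENNReal.mul_iSup]
  refine iSup_le fun j => ?_
  refine prekopaLeindler_real_of_bdd ha hb hab (hf.min measurable_const) (hg.min measurable_const)
    hh (hb' f i) (hb' g j) fun x y => le_trans ?_ (H x y)
  gcongr <;> exact min_le_left _ _

theorem PrekopaLeindler.prod {G H : Type*} [AddCommGroup G] [Module ℝ G] [MeasurableSpace G]
    [AddCommGroup H] [Module ℝ H] [MeasurableSpace H] {μ : Measure G} {ν : Measure H} [SFinite μ]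
    [SFinite ν] (hμ : PrekopaLeindler μ) (hν : PrekopaLeindler ν) :
    PrekopaLeindler (μ.prod ν) := by
  intro a b ha hb hab f g h hf hg hh H
  rw [lintegral_prod _ hf.aemeasurable, lintegral_prod _ hg.aemeasurable,
    lintegral_prod _ hh.aemeasurable]
  refine hμ a b ha hb hab _ _ _ hf.lintegral_prod_right' hg.lintegral_prod_right'
    hh.lintegral_prod_right' fun x y => ?_
  refine hν a b ha hb hab _ _ _ (by fun_prop) (by fun_prop) (by fun_prop) fun z w => ?_
  exact H (x, z) (y, w)

theorem prekopaLeindler_pi (m : ℕ) : PrekopaLeindler (volume : Measure (Fin m → ℝ)) := by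
  induction m with
  | zero =>
    intro a b ha hb hab f g h hf hg hh H
    simp only [lintegral_unique, volume_pi, Measure.pi_empty_univ, mul_one]
    convert H default default
  | succ m ih =>
    intro a b ha hb hab f g h hf hg hh H
    have e := (volume_preserving_piFinSuccAbove (fun _ : Fin (m + 1) => ℝ) 0).symm
    rw [← e.lintegral_comp hf, ← e.lintegral_comp hg, ← e.lintegral_comp hh]
    refine prekopaLeindler_real.prod ih a b ha hb hab _ _ _ (hf.comp e.measurable)
      (hg.comp e.measurable) (hh.comp e.measurable) fun x y => ?_
    refine (H _ _).trans_eq (congrArg h ?_)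
    ext i
    refine Fin.cases ?_ (fun i => ?_) i <;>
      simp [MeasurableEquiv.piFinSuccAbove_symm_apply, Fin.insertNthEquiv]

/-- The squared Euclidean norm on `ℝ × ℝᵐ`. -/
def prodNormSq {m : ℕ} (z : ℝ × (Fin m → ℝ)) : ℝ :=
  z.1 ^ 2 + ∑ i, z.2 i ^ 2

theorem prodNormSq_nonneg {m : ℕ} (z : ℝ × (Fin m → ℝ)) : 0 ≤ prodNormSq z := by
  unfold prodNormSq
  positivity

@[fun_prop]
theorem measurable_prodNormSq {m : ℕ} :
    Measurable (prodNormSq : ℝ × (Fin m → ℝ) → ℝ) := by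
  unfold prodNormSq
  fun_prop

theorem prodNormSq_smul {m : ℕ} (c : ℝ) (z : ℝ × (Fin m → ℝ)) :
    prodNormSq (c • z) = c ^ 2 * prodNormSq z := by
  simp [prodNormSq, mul_pow, mul_add, Finset.mul_sum]

theorem prodNormSq_convex_comb_le {m : ℕ} {a b : ℝ} (ha : 0 ≤ a) (hb : 0 ≤ b) (hab : a + b = 1)
    (x y : ℝ × (Fin m → ℝ)) :
    prodNormSq (a • x + b • y) ≤ a * prodNormSq x + b * prodNormSq y := by
  have h : ∀ u w : ℝ, (a * u + b * w) ^ 2 ≤ a * u ^ 2 + b * w ^ 2 := fun u w => by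
    obtain rfl : b = 1 - a := by linarith
    nlinarith [mul_nonneg (mul_nonneg ha hb) (sq_nonneg (u - w))]
  calc prodNormSq (a • x + b • y)
      = (a * x.1 + b * y.1) ^ 2 + ∑ i, (a * x.2 i + b * y.2 i) ^ 2 := by simp [prodNormSq]
    _ ≤ (a * x.1 ^ 2 + b * y.1 ^ 2) + ∑ i, (a * x.2 i ^ 2 + b * y.2 i ^ 2) :=
        add_le_add (h _ _) (Finset.sum_le_sum fun i _ => h _ _)
    _ = _ := by
        rw [Finset.sum_add_distrib, ← Finset.mul_sum, ← Finset.mul_sum, prodNormSq, prodNormSq]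
        ring

/-- Measurable convex cones in `ℝ × (ℝ × ℝᵐ)` invariant under `(g, (t, z)) ↦ (-g, (t, -z))`. -/
structure IsReflCone {m : ℕ} (C : Set (ℝ × (ℝ × (Fin m → ℝ)))) : Prop where
  measurableSet : MeasurableSet C
  add_mem : ∀ x ∈ C, ∀ y ∈ C, x + y ∈ C
  smul_mem : ∀ c : ℝ, 0 < c → ∀ x ∈ C, c • x ∈ C
  refl_mem : ∀ g t z, (g, (t, z)) ∈ C → (-g, (t, -z)) ∈ C

/-- The part of the slice of `C` at height `g` lying in the open ball of squared radius `s`. -/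
def coneBall {m : ℕ} (C : Set (ℝ × (ℝ × (Fin m → ℝ)))) (g s : ℝ) : Set (ℝ × (Fin m → ℝ)) :=
  {z | (g, z) ∈ C ∧ prodNormSq z < s}

section

variable {m : ℕ} {C : Set (ℝ × (ℝ × (Fin m → ℝ)))}

theorem coneBall_eq_empty {g s : ℝ} (hs : s ≤ 0) : coneBall C g s = ∅ :=
  Set.eq_empty_of_forall_notMem fun z hz => absurd (prodNormSq_nonneg z) (by linarith [hz.2])

theorem IsReflCone.measurableSet_coneBall (hC : IsReflCone C) (g s : ℝ) :
    MeasurableSet (coneBall C g s) :=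
  (hC.measurableSet.preimage measurable_prodMk_left).inter
    (measurableSet_lt measurable_prodNormSq measurable_const)

theorem IsReflCone.volume_coneBall_neg (hC : IsReflCone C) (g s : ℝ) :
    volume (coneBall C (-g) s) = volume (coneBall C g s) := by
  have h : MeasurePreserving (Prod.map id Neg.neg : ℝ × (Fin m → ℝ) → ℝ × (Fin m → ℝ)) :=
    (MeasurePreserving.id volume).prod (Measure.measurePreserving_neg volume)
  rw [← h.measure_preimage (hC.measurableSet_coneBall _ _).nullMeasurableSet]
  congr 1
  ext ⟨t, z⟩
  have : (-g, (t, -z)) ∈ C ↔ (g, (t, z)) ∈ C :=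
    ⟨fun h => by simpa using hC.refl_mem _ _ _ h, hC.refl_mem _ _ _⟩
  simp [coneBall, this, prodNormSq]

theorem IsReflCone.volume_coneBall_le_of_convex_comb (hC : IsReflCone C) {a b : ℝ} (ha : 0 < a)
    (hb : 0 < b) (hab : a + b = 1) (g s : ℝ) :
    volume (coneBall C g s) ≤ volume (coneBall C (a * g + b * -g) s) := by
  have hPL : PrekopaLeindler (volume : Measure (ℝ × (Fin m → ℝ))) :=
    prekopaLeindler_real.prod (prekopaLeindler_pi m)
  have key := hPL a b ha hb hab ((coneBall C g s).indicator 1) ((coneBall C (-g) s).indicator 1)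
    ((coneBall C (a * g + b * -g) s).indicator 1)
    (measurable_one.indicator (hC.measurableSet_coneBall _ _))
    (measurable_one.indicator (hC.measurableSet_coneBall _ _))
    (measurable_one.indicator (hC.measurableSet_coneBall _ _)) ?_
  · rw [lintegral_indicator_one (hC.measurableSet_coneBall _ _),
      lintegral_indicator_one (hC.measurableSet_coneBall _ _),
      lintegral_indicator_one (hC.measurableSet_coneBall _ _), hC.volume_coneBall_neg,
      ← ENNReal.rpow_add_of_nonneg _ _ ha.le hb.le, hab, ENNReal.rpow_one] at key
    exact key
  · intro x y
    by_cases hx : x ∈ coneBall C g s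
    · by_cases hy : y ∈ coneBall C (-g) s
      · have : a • x + b • y ∈ coneBall C (a * g + b * -g) s := by
          refine ⟨hC.add_mem _ (hC.smul_mem a ha _ hx.1) _ (hC.smul_mem b hb _ hy.1), ?_⟩
          refine (prodNormSq_convex_comb_le ha.le hb.le hab x y).trans_lt ?_
          calc a * prodNormSq x + b * prodNormSq y < a * s + b * s :=
                add_lt_add (mul_lt_mul_of_pos_left hx.2 ha) (mul_lt_mul_of_pos_left hy.2 hb)
            _ = s := by rw [← add_mul, hab, one_mul]
        rw [Set.indicator_of_mem hx, Set.indicator_of_mem hy, Set.indicator_of_mem this]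
        simp
      · simp [hy, hb]
    · simp [hx, ha]

theorem IsReflCone.volume_coneBall_anti (hC : IsReflCone C) {g g' : ℝ} (h : |g'| ≤ |g|) (s : ℝ) :
    volume (coneBall C g s) ≤ volume (coneBall C g' s) := by
  rcases h.eq_or_lt with h | h
  · rcases abs_eq_abs.1 h with rfl | rfl
    · rfl
    · rw [hC.volume_coneBall_neg]
  have hg : 0 < |g| := (abs_nonneg _).trans_lt h
  have hg0 : g ≠ 0 := abs_pos.1 hg
  have h1 : |g' / g| < 1 := by rwa [abs_div, div_lt_one hg]
  obtain ⟨h2, h3⟩ := abs_lt.1 h1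
  convert hC.volume_coneBall_le_of_convex_comb (a := (1 + g' / g) / 2) (b := (1 - g' / g) / 2)
    (by linarith) (by linarith) (by ring) g s using 3
  field_simp
  ring

open scoped Pointwise in
theorem IsReflCone.volume_coneBall_sq (hC : IsReflCone C) (g : ℝ) {r : ℝ} (hr : 0 < r) :
    volume (coneBall C g (r ^ 2)) =
      ENNReal.ofReal (r ^ (m + 1)) * volume (coneBall C (g / r) 1) := by
  have : coneBall C g (r ^ 2) = r • coneBall C (g / r) 1 := by
    ext z
    rw [Set.mem_smul_set_iff_inv_smul_mem₀ hr.ne']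
    refine and_congr ⟨fun h => ?_, fun h => ?_⟩ ?_
    · simpa [div_eq_inv_mul] using hC.smul_mem r⁻¹ (inv_pos.2 hr) _ h
    · simpa [hr.ne', mul_div_cancel₀, smul_smul] using hC.smul_mem r hr _ h
    · rw [prodNormSq_smul, inv_pow, inv_mul_lt_one₀ (by positivity)]
  have : (volume : Measure (ℝ × (Fin m → ℝ))).IsAddHaarMeasure :=
    Measure.prod.instIsAddHaarMeasure volume volume
  rw [‹coneBall C g (r ^ 2) = _›, Measure.addHaar_smul]
  simp [abs_of_pos hr, add_comm]

theorem IsReflCone.volume_coneBall_sq_le (hC : IsReflCone C) (g : ℝ) {r s : ℝ} (hr : 0 ≤ r)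
    (hs : 0 < s) (hrs : r ≤ s) :
    volume (coneBall C g (r ^ 2)) ≤
      ENNReal.ofReal (r ^ (m + 1)) * volume (coneBall C (g / s) 1) := by
  rcases hr.eq_or_lt with rfl | hr
  · simp [coneBall_eq_empty]
  · rw [hC.volume_coneBall_sq g hr]
    refine mul_le_mul_right (hC.volume_coneBall_anti ?_ 1) _
    rw [abs_div, abs_div, abs_of_pos hs, abs_of_pos hr]
    gcongr

theorem isReflCone_halfSpace (m : ℕ) :
    IsReflCone {p : ℝ × (ℝ × (Fin m → ℝ)) | 0 < p.2.1} where
  measurableSet := measurableSet_lt measurable_const (by fun_prop)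
  add_mem x hx y hy := add_pos (show 0 < x.2.1 from hx) (show 0 < y.2.1 from hy)
  smul_mem c hc x hx := mul_pos hc (show 0 < x.2.1 from hx)
  refl_mem g t z h := h

theorem volume_coneBall_halfSpace_sq (m : ℕ) (g : ℝ) {r : ℝ} (hr : 0 ≤ r) :
    volume (coneBall {p : ℝ × (ℝ × (Fin m → ℝ)) | 0 < p.2.1} g (r ^ 2)) =
      ENNReal.ofReal (r ^ (m + 1)) *
        volume (coneBall {p : ℝ × (ℝ × (Fin m → ℝ)) | 0 < p.2.1} 0 1) := by
  rcases hr.eq_or_lt with rfl | hr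
  · simp [coneBall_eq_empty]
  · exact (isReflCone_halfSpace m).volume_coneBall_sq g hr

theorem IsReflCone.volume_coneBall_rearrangement (hC : IsReflCone C) (ρ g g' : ℝ) :
    volume (coneBall C g (min (1 - g ^ 2) (ρ * g ^ 2))) *
        volume (coneBall {p : ℝ × (ℝ × (Fin m → ℝ)) | 0 < p.2.1} g' (1 - g' ^ 2)) +
      volume (coneBall C g' (min (1 - g' ^ 2) (ρ * g' ^ 2))) *
        volume (coneBall {p : ℝ × (ℝ × (Fin m → ℝ)) | 0 < p.2.1} g (1 - g ^ 2)) ≤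
    volume (coneBall C g (1 - g ^ 2)) *
        volume (coneBall {p : ℝ × (ℝ × (Fin m → ℝ)) | 0 < p.2.1} g'
          (min (1 - g' ^ 2) (ρ * g' ^ 2))) +
      volume (coneBall C g' (1 - g' ^ 2)) *
        volume (coneBall {p : ℝ × (ℝ × (Fin m → ℝ)) | 0 < p.2.1} g
          (min (1 - g ^ 2) (ρ * g ^ 2))) := by
  wlog hgg : |g| ≤ |g'| generalizing g g'
  · rw [add_comm]
    refine (this g' g (le_of_not_ge hgg)).trans_eq (add_comm _ _)
  rcases le_or_gt (1 - g' ^ 2) 0 with hg' | hg'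
  · simp [coneBall_eq_empty hg', coneBall_eq_empty ((min_le_left _ _).trans hg')]
  have hsq : g ^ 2 ≤ g' ^ 2 := sq_le_sq.2 hgg
  rcases le_or_gt ρ 0 with hρ | hρ
  · have h0 : ∀ x : ℝ, min (1 - x ^ 2) (ρ * x ^ 2) ≤ 0 := fun x =>
      (min_le_right _ _).trans (mul_nonpos_of_nonpos_of_nonneg hρ (sq_nonneg x))
    simp [coneBall_eq_empty (h0 _)]
  have hg : 0 < 1 - g ^ 2 := by linarith
  have hroot : ∀ x : ℝ, 0 ≤ x → ∃ y, 0 ≤ y ∧ y ^ 2 = x := fun x hx =>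
    ⟨√x, Real.sqrt_nonneg x, Real.sq_sqrt hx⟩
  obtain ⟨T, hT0, hT⟩ := hroot _ hg.le
  obtain ⟨T', hT0', hT'⟩ := hroot _ hg'.le
  obtain ⟨r, hr0, hr⟩ := hroot (min (1 - g ^ 2) (ρ * g ^ 2)) (le_min hg.le (by positivity))
  obtain ⟨r', hr0', hr'⟩ := hroot (min (1 - g' ^ 2) (ρ * g' ^ 2)) (le_min hg'.le (by positivity))
  have hTpos : 0 < T := lt_of_le_of_ne hT0 (by rintro rfl; simp at hT; linarith)
  have hTpos' : 0 < T' := lt_of_le_of_ne hT0' (by rintro rfl; simp at hT'; linarith)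
  have hTT : T' ≤ T := by
    refine le_of_sq_le_sq ?_ hT0
    linarith
  have hrT : r ≤ T := le_of_sq_le_sq (by rw [hr, hT]; exact min_le_left _ _) hT0
  have hrT' : r' ≤ T' := le_of_sq_le_sq (by rw [hr', hT']; exact min_le_left _ _) hT0'
  have hcross : r * T' ≤ r' * T := by
    refine le_of_sq_le_sq ?_ (by positivity)
    rw [mul_pow, mul_pow, hr', min_mul_of_nonneg _ _ (sq_nonneg T)]
    refine le_min ?_ ?_
    · rw [hT', mul_comm, hT]
      exact mul_le_mul_of_nonneg_left (hr.trans_le (min_le_left _ _)) hg'.le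
    · calc r ^ 2 * T' ^ 2 ≤ (ρ * g ^ 2) * T ^ 2 := by
            gcongr
            exact hr.trans_le (min_le_right _ _)
        _ ≤ ρ * g' ^ 2 * T ^ 2 := by gcongr
  have hJ : volume (coneBall C (g' / T') 1) ≤ volume (coneBall C (g / T) 1) := by
    refine hC.volume_coneBall_anti ?_ 1
    rw [abs_div, abs_div, abs_of_pos hTpos, abs_of_pos hTpos']
    gcongr
  have hR : ENNReal.ofReal (r ^ (m + 1)) * ENNReal.ofReal (T' ^ (m + 1)) ≤
      ENNReal.ofReal (r' ^ (m + 1)) * ENNReal.ofReal (T ^ (m + 1)) := by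
    rw [← ENNReal.ofReal_mul (by positivity), ← ENNReal.ofReal_mul (by positivity), ← mul_pow,
      ← mul_pow]
    gcongr
  rw [← hr, ← hr', ← hT, ← hT']
  simp only [volume_coneBall_halfSpace_sq m _ hr0, volume_coneBall_halfSpace_sq m _ hr0',
    volume_coneBall_halfSpace_sq m _ hT0, volume_coneBall_halfSpace_sq m _ hT0',
    hC.volume_coneBall_sq _ hTpos, hC.volume_coneBall_sq _ hTpos']
  grw [hC.volume_coneBall_sq_le g hr0 hTpos hrT, hC.volume_coneBall_sq_le g' hr0' hTpos' hrT']
  generalize volume (coneBall {p : ℝ × (ℝ × (Fin m → ℝ)) | 0 < p.2.1} 0 1) = β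
  generalize volume (coneBall C (g / T) 1) = J at *
  generalize volume (coneBall C (g' / T') 1) = J' at *
  calc _ = (J' * (ENNReal.ofReal (r' ^ (m + 1)) * ENNReal.ofReal (T ^ (m + 1))) +
        J * (ENNReal.ofReal (r ^ (m + 1)) * ENNReal.ofReal (T' ^ (m + 1)))) * β := by ring
    _ ≤ (J' * (ENNReal.ofReal (r ^ (m + 1)) * ENNReal.ofReal (T' ^ (m + 1))) +
        J * (ENNReal.ofReal (r' ^ (m + 1)) * ENNReal.ofReal (T ^ (m + 1)))) * β := by
        gcongr ?_ * β
        obtain ⟨j, rfl⟩ := le_iff_exists_add.1 hJ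
        obtain ⟨d, hd⟩ := le_iff_exists_add.1 hR
        rw [hd]
        refine le_iff_exists_add.2 ⟨j * d, ?_⟩
        ring
    _ = _ := by ring

theorem IsReflCone.measurable_volume_coneBall (hC : IsReflCone C) {s : ℝ → ℝ} (hs : Measurable s) :
    Measurable fun g => volume (coneBall C g (s g)) := by
  have : MeasurableSet {p : ℝ × (ℝ × (Fin m → ℝ)) | p ∈ C ∧ prodNormSq p.2 < s p.1} :=
    hC.measurableSet.inter (measurableSet_lt
      (measurable_prodNormSq.comp measurable_snd) (hs.comp measurable_fst))
  exact measurable_measure_prodMk_left this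

theorem IsReflCone.lintegral_volume_coneBall_mul_le (hC : IsReflCone C) (ρ : ℝ) :
    (∫⁻ g, volume (coneBall C g (min (1 - g ^ 2) (ρ * g ^ 2)))) *
        (∫⁻ g, volume (coneBall {p : ℝ × (ℝ × (Fin m → ℝ)) | 0 < p.2.1} g (1 - g ^ 2))) ≤
      (∫⁻ g, volume (coneBall C g (1 - g ^ 2))) *
        ∫⁻ g, volume (coneBall {p : ℝ × (ℝ × (Fin m → ℝ)) | 0 < p.2.1} g
          (min (1 - g ^ 2) (ρ * g ^ 2))) := by
  have hH := isReflCone_halfSpace m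
  have m1 : Measurable fun g : ℝ => 1 - g ^ 2 := by fun_prop
  have m2 : Measurable fun g : ℝ => min (1 - g ^ 2) (ρ * g ^ 2) := by fun_prop
  have double : ∀ u w : ℝ → ℝ≥0∞, Measurable u → Measurable w →
      ∫⁻ g, ∫⁻ g', (u g * w g' + u g' * w g) = 2 * ((∫⁻ g, u g) * ∫⁻ g, w g) := by
    intro u w hu hw
    have : ∀ g, ∫⁻ g', (u g * w g' + u g' * w g) =
        u g * (∫⁻ g, w g) + (∫⁻ g, u g) * w g := fun g => by
      rw [lintegral_add_left (hw.const_mul _), lintegral_const_mul _ hw, lintegral_mul_const _ hu]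
    simp only [this]
    rw [lintegral_add_left (hu.mul_const _), lintegral_mul_const _ hu, lintegral_const_mul _ hw,
      two_mul]
  have key := lintegral_mono (μ := volume) fun g => lintegral_mono (μ := volume) fun g' =>
    hC.volume_coneBall_rearrangement ρ g g'
  rw [double _ _ (hC.measurable_volume_coneBall m2) (hH.measurable_volume_coneBall m1),
    double _ _ (hC.measurable_volume_coneBall m1) (hH.measurable_volume_coneBall m2)] at key
  exact (ENNReal.mul_le_mul_iff_right (by simp) (by simp)).1 key

end

theorem exists_measurePreserving_coord (m : ℕ) (v : EuclideanSpace ℝ (Fin (m + 1)))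
    (hv : ‖v‖ = 1) :
    ∃ φ : (ℝ × (Fin m → ℝ)) →ₗ[ℝ] EuclideanSpace ℝ (Fin (m + 1)),
      MeasurePreserving φ volume volume ∧ (∀ p, ⟪φ p, v⟫ = p.1) ∧
        ∀ p, ‖φ p‖ ^ 2 = p.1 ^ 2 + ∑ i, p.2 i ^ 2 := by
  set e : EuclideanSpace ℝ (Fin (m + 1)) := EuclideanSpace.single 0 1
  have he : ‖e‖ = ‖v‖ := by simp [e, hv]
  set R := Submodule.reflection (ℝ ∙ (e - v))ᗮ
  have hR : R e = v := Submodule.reflection_sub he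
  let ψ : (ℝ × (Fin m → ℝ)) →ₗ[ℝ] EuclideanSpace ℝ (Fin (m + 1)) :=
    { toFun := fun p => WithLp.toLp 2 (Fin.cons p.1 p.2)
      map_add' := fun p q => by
        ext i
        refine Fin.cases ?_ (fun i => ?_) i <;> simp
      map_smul' := fun c p => by
        ext i
        refine Fin.cases ?_ (fun i => ?_) i <;> simp }
  have hψ : MeasurePreserving ψ volume volume := by
    have h := (PiLp.volume_preserving_toLp (Fin (m + 1))).comp
      (volume_preserving_piFinSuccAbove (fun _ : Fin (m + 1) => ℝ) 0).symm
    have hcomp : ⇑ψ = WithLp.toLp 2 ∘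
        (MeasurableEquiv.piFinSuccAbove (fun _ : Fin (m + 1) => ℝ) 0).symm := by
      refine funext fun p => PiLp.ext fun i => ?_
      refine Fin.cases ?_ (fun i => ?_) i <;>
        simp [ψ, MeasurableEquiv.piFinSuccAbove_symm_apply, Fin.insertNthEquiv]
    rw [hcomp]
    exact h
  refine ⟨R.toLinearEquiv.toLinearMap ∘ₗ ψ, R.measurePreserving.comp hψ, fun p => ?_, fun p => ?_⟩
  · calc ⟪R (ψ p), v⟫ = ⟪R (ψ p), R e⟫ := by rw [hR]
      _ = ⟪ψ p, e⟫ := R.inner_map_map _ _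
      _ = p.1 := by simp [e, ψ, EuclideanSpace.inner_single_right]
  · calc ‖R (ψ p)‖ ^ 2 = ‖ψ p‖ ^ 2 := by rw [R.norm_map]
      _ = p.1 ^ 2 + ∑ i, p.2 i ^ 2 := by
        rw [EuclideanSpace.norm_sq_eq, Fin.sum_univ_succ]
        simp [ψ]

theorem ofReal_rpow_eq_lintegral (n : ℕ) {A : ℝ} (hA : 0 < A) :
    ENNReal.ofReal (A ^ (-(((n : ℝ) + 1) / 2))) = ENNReal.ofReal (n + 1) *
      ∫⁻ t, {t : ℝ | 0 < t ∧ t ^ 2 * A < 1}.indicator (fun t => ENNReal.ofReal (t ^ n)) t := by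
  have hR : 0 < (√A)⁻¹ := inv_pos.2 (Real.sqrt_pos.2 hA)
  have hset : {t : ℝ | 0 < t ∧ t ^ 2 * A < 1} = Set.Ioo 0 (√A)⁻¹ := by
    ext t
    refine and_congr_right fun ht => ?_
    rw [← Real.sqrt_inv, Real.lt_sqrt ht.le, lt_inv_comm₀ (by positivity) hA, ← one_div,
      lt_div_iff₀ (by positivity), mul_comm]
  have hint : ∫⁻ t in Set.Ioo 0 (√A)⁻¹, ENNReal.ofReal (t ^ n) =
      ENNReal.ofReal ((√A)⁻¹ ^ (n + 1) / (n + 1)) := by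
    rw [restrict_Ioo_eq_restrict_Ioc, ← ofReal_integral_eq_lintegral_ofReal,
      ← intervalIntegral.integral_of_le hR.le, integral_pow]
    · simp
    · exact (continuous_pow n).integrableOn_Ioc
    · exact (ae_restrict_iff' measurableSet_Ioc).2 (.of_forall fun t ht => pow_nonneg ht.1.le n)
  rw [hset, lintegral_indicator measurableSet_Ioo, hint, ← ENNReal.ofReal_mul (by positivity),
    mul_div_cancel₀ _ (by positivity), Real.sqrt_eq_rpow, ← Real.rpow_neg hA.le,
    ← Real.rpow_natCast, ← Real.rpow_mul hA.le]
  congr 2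
  push_cast
  ring

/-- The open cone over `S`, in coordinates adapted to a linear map `φ`. -/
def coneOver {m : ℕ} (φ : (ℝ × (Fin m → ℝ)) →ₗ[ℝ] EuclideanSpace ℝ (Fin (m + 1)))
    (S : Set (EuclideanSpace ℝ (Fin (m + 1)))) : Set (ℝ × (ℝ × (Fin m → ℝ))) :=
  {p | 0 < p.2.1 ∧ p.2.1⁻¹ • φ (p.1, p.2.2) ∈ S}

section

variable {m : ℕ} {φ : (ℝ × (Fin m → ℝ)) →ₗ[ℝ] EuclideanSpace ℝ (Fin (m + 1))}
  {S : Set (EuclideanSpace ℝ (Fin (m + 1)))}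

theorem measurableSet_coneOver (hφ : Measurable φ) (hS : MeasurableSet S) :
    MeasurableSet (coneOver φ S) :=
  MeasurableSet.inter (s₁ := {p : ℝ × (ℝ × (Fin m → ℝ)) | 0 < p.2.1})
    (measurableSet_lt measurable_const (by fun_prop))
    (hS.preimage (f := fun p : ℝ × (ℝ × (Fin m → ℝ)) => p.2.1⁻¹ • φ (p.1, p.2.2)) (by fun_prop))

theorem isReflCone_coneOver (hφ : Measurable φ) (hS : MeasurableSet S) (hconv : Convex ℝ S)
    (hsymm : ∀ x ∈ S, -x ∈ S) : IsReflCone (coneOver φ S) where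
  measurableSet := measurableSet_coneOver hφ hS
  add_mem := by
    rintro ⟨g, t, z⟩ ⟨ht, h⟩ ⟨g', t', z'⟩ ⟨ht', h'⟩
    simp only at ht h ht' h'
    have hpos : 0 < t + t' := add_pos ht ht'
    refine ⟨hpos, ?_⟩
    convert hconv h h' (a := t / (t + t')) (b := t' / (t + t')) (by positivity) (by positivity)
      (by field_simp) using 1
    have : ((g, t, z) + (g', t', z') : ℝ × (ℝ × (Fin m → ℝ))) = (g + g', t + t', z + z') := rfl
    rw [this]
    simp only
    rw [show ((g + g', z + z') : ℝ × (Fin m → ℝ)) = (g, z) + (g', z') from rfl, map_add,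
      smul_add, smul_smul, smul_smul]
    congr 2 <;> field_simp
  smul_mem := by
    rintro c hc ⟨g, t, z⟩ ⟨ht, h⟩
    refine ⟨mul_pos hc ht, ?_⟩
    convert h using 1
    change (c * t)⁻¹ • φ (c • (g, z)) = t⁻¹ • φ (g, z)
    rw [map_smul, smul_smul]
    congr 1
    field_simp
  refl_mem := by
    rintro g t z ⟨ht, h⟩
    refine ⟨ht, ?_⟩
    convert hsymm _ h using 1
    change t⁻¹ • φ (-(g, z)) = -(t⁻¹ • φ (g, z))
    rw [map_neg, smul_neg]

theorem coneOver_univ :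
    coneOver φ Set.univ = {p : ℝ × (ℝ × (Fin m → ℝ)) | 0 < p.2.1} := by
  simp [coneOver]

open scoped Pointwise in
theorem setLIntegral_cauchyDensity (hφ : MeasurePreserving φ volume volume)
    (hnorm : ∀ p, ‖φ p‖ ^ 2 = p.1 ^ 2 + ∑ i, p.2 i ^ 2) (hS : MeasurableSet S) :
    ∫⁻ x in S, ENNReal.ofReal (cauchyDensity (m + 1) x) =
      ENNReal.ofReal ((m + 1 : ℕ) + 1) * ∫⁻ g, volume (coneBall (coneOver φ S) g (1 - g ^ 2)) := by
  have hmeas : MeasurableSet {p : ℝ × EuclideanSpace ℝ (Fin (m + 1)) |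
      0 < p.1 ∧ p.1 ^ 2 * (1 + ‖p.2‖ ^ 2) < 1} :=
    MeasurableSet.inter (s₁ := {p : ℝ × EuclideanSpace ℝ (Fin (m + 1)) | 0 < p.1})
      (s₂ := {p | p.1 ^ 2 * (1 + ‖p.2‖ ^ 2) < 1})
      (measurableSet_lt measurable_const (by fun_prop))
      (measurableSet_lt (by fun_prop) measurable_const)
  have hF : Measurable fun p : ℝ × EuclideanSpace ℝ (Fin (m + 1)) =>
      {p : ℝ × EuclideanSpace ℝ (Fin (m + 1)) |
        0 < p.1 ∧ p.1 ^ 2 * (1 + ‖p.2‖ ^ 2) < 1}.indicator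
        (fun p => ENNReal.ofReal (p.1 ^ (m + 1))) p :=
    Measurable.indicator (by fun_prop) hmeas
  have hcone : MeasurableSet {p : ℝ × (ℝ × (Fin m → ℝ)) |
      p ∈ coneOver φ S ∧ prodNormSq p.2 < 1 - p.1 ^ 2} :=
    (measurableSet_coneOver hφ.measurable hS).inter (measurableSet_lt
      (measurable_prodNormSq.comp measurable_snd) (by fun_prop))
  have hslice : ∀ t : ℝ, (∫⁻ x in S,
      {t : ℝ | 0 < t ∧ t ^ 2 * (1 + ‖x‖ ^ 2) < 1}.indicator
        (fun t => ENNReal.ofReal (t ^ (m + 1))) t) =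
      ∫⁻ g, volume {z : Fin m → ℝ |
        (g, (t, z)) ∈ coneOver φ S ∧ prodNormSq (t, z) < 1 - g ^ 2} := by
    intro t
    rcases le_or_gt t 0 with ht | ht
    · simp [coneOver, ht.not_gt]
    have hBm : MeasurableSet {x : EuclideanSpace ℝ (Fin (m + 1)) | t ^ 2 * (1 + ‖x‖ ^ 2) < 1} :=
      measurableSet_lt (by fun_prop) measurable_const
    calc _ = ∫⁻ x in S, {x : EuclideanSpace ℝ (Fin (m + 1)) |
            t ^ 2 * (1 + ‖x‖ ^ 2) < 1}.indicator (fun _ => ENNReal.ofReal (t ^ (m + 1))) x := by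
          simp [Set.indicator_apply, ht]
      _ = ENNReal.ofReal (t ^ (m + 1)) * volume ({x : EuclideanSpace ℝ (Fin (m + 1)) |
            t ^ 2 * (1 + ‖x‖ ^ 2) < 1} ∩ S) := by
          rw [lintegral_indicator_const hBm, Measure.restrict_apply hBm]
      _ = volume (t • ({x : EuclideanSpace ℝ (Fin (m + 1)) |
            t ^ 2 * (1 + ‖x‖ ^ 2) < 1} ∩ S)) := by
          rw [Measure.addHaar_smul]
          simp [abs_of_pos ht]
      _ = volume (φ ⁻¹' (t • ({x : EuclideanSpace ℝ (Fin (m + 1)) |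
            t ^ 2 * (1 + ‖x‖ ^ 2) < 1} ∩ S))) :=
          (hφ.measure_preimage ((hBm.inter hS).const_smul₀ t).nullMeasurableSet).symm
      _ = volume {p : ℝ × (Fin m → ℝ) | (p.1, (t, p.2)) ∈ coneOver φ S ∧
            prodNormSq (t, p.2) < 1 - p.1 ^ 2} := by
          congr 1
          ext p
          rw [Set.mem_preimage, Set.mem_smul_set_iff_inv_smul_mem₀ ht.ne']
          simp only [Set.mem_inter_iff, Set.mem_ofPred_eq, coneOver, ht, true_and, Prod.mk.eta]
          rw [and_comm]
          refine and_congr_right fun _ => ?_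
          rw [norm_smul, mul_pow, hnorm, prodNormSq, Real.norm_eq_abs, sq_abs, mul_add,
            ← mul_assoc, ← mul_pow, mul_inv_cancel₀ ht.ne']
          constructor <;> intro h <;> linarith
      _ = _ := by
          have : MeasurableSet {p : ℝ × (Fin m → ℝ) | (p.1, (t, p.2)) ∈ coneOver φ S ∧
            prodNormSq (t, p.2) < 1 - p.1 ^ 2} :=
            hcone.preimage (f := fun p : ℝ × (Fin m → ℝ) => (p.1, (t, p.2))) (by fun_prop)
          exact Measure.prod_apply this
  calc _ = ∫⁻ x in S, ENNReal.ofReal ((m + 1 : ℕ) + 1) *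
        ∫⁻ t, {t : ℝ | 0 < t ∧ t ^ 2 * (1 + ‖x‖ ^ 2) < 1}.indicator
          (fun t => ENNReal.ofReal (t ^ (m + 1))) t :=
        lintegral_congr fun x => ofReal_rpow_eq_lintegral (m + 1) (by positivity)
    _ = ENNReal.ofReal ((m + 1 : ℕ) + 1) * ∫⁻ x in S,
        ∫⁻ t, {t : ℝ | 0 < t ∧ t ^ 2 * (1 + ‖x‖ ^ 2) < 1}.indicator
          (fun t => ENNReal.ofReal (t ^ (m + 1))) t :=
        lintegral_const_mul' _ _ ENNReal.ofReal_ne_top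
    _ = ENNReal.ofReal ((m + 1 : ℕ) + 1) * ∫⁻ t, ∫⁻ x in S,
        {t : ℝ | 0 < t ∧ t ^ 2 * (1 + ‖x‖ ^ 2) < 1}.indicator
          (fun t => ENNReal.ofReal (t ^ (m + 1))) t := by
        rw [lintegral_lintegral_swap]
        exact (hF.comp measurable_swap).aemeasurable
    _ = ENNReal.ofReal ((m + 1 : ℕ) + 1) * ∫⁻ g, ∫⁻ t, volume {z : Fin m → ℝ |
        (g, (t, z)) ∈ coneOver φ S ∧ prodNormSq (t, z) < 1 - g ^ 2} := by
        rw [lintegral_congr hslice, lintegral_lintegral_swap]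
        have : MeasurableSet {q : (ℝ × ℝ) × (Fin m → ℝ) | (q.1.2, (q.1.1, q.2)) ∈ coneOver φ S ∧
            prodNormSq (q.1.1, q.2) < 1 - q.1.2 ^ 2} :=
          hcone.preimage (f := fun q : (ℝ × ℝ) × (Fin m → ℝ) => (q.1.2, (q.1.1, q.2)))
            (by fun_prop)
        exact (measurable_measure_prodMk_left this).aemeasurable
    _ = _ := by
        congr 1
        refine lintegral_congr fun g => ?_
        have : MeasurableSet (coneBall (coneOver φ S) g (1 - g ^ 2)) :=
          hcone.preimage (f := fun q : ℝ × (Fin m → ℝ) => (g, q)) (by fun_prop)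
        exact (Measure.prod_apply this).symm

theorem coneBall_coneOver_inter {v : EuclideanSpace ℝ (Fin (m + 1))}
    (hinner : ∀ p, ⟪φ p, v⟫ = p.1)
    (hnorm : ∀ p, ‖φ p‖ ^ 2 = p.1 ^ 2 + ∑ i, p.2 i ^ 2) {s : ℝ} (hs : 0 < s) (g r : ℝ) :
    coneBall (coneOver φ (S ∩ {x | ⟪x, v⟫ ^ 2 ≤ s ^ 2 * (1 + ‖x‖ ^ 2)}ᶜ)) g r =
      coneBall (coneOver φ S) g (min r ((1 - s ^ 2) / s ^ 2 * g ^ 2)) := by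
  ext ⟨t, z⟩
  simp only [coneBall, coneOver, Set.mem_ofPred_eq, Set.mem_inter_iff, Set.mem_compl_iff, not_le,
    lt_min_iff]
  have key : 0 < t → (s ^ 2 * (1 + ‖t⁻¹ • φ (g, z)‖ ^ 2) < ⟪t⁻¹ • φ (g, z), v⟫ ^ 2 ↔
      prodNormSq (t, z) < (1 - s ^ 2) / s ^ 2 * g ^ 2) := by
    intro ht
    rw [norm_smul, mul_pow, hnorm, inner_smul_left, hinner, prodNormSq, Real.norm_eq_abs, sq_abs,
      div_mul_eq_mul_div, lt_div_iff₀ (by positivity)]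
    simp only [conj_trivial]
    rw [mul_pow, ← mul_lt_mul_iff_right₀ (show 0 < t ^ 2 by positivity)]
    have h1 : t ^ 2 * (s ^ 2 * (1 + t⁻¹ ^ 2 * (g ^ 2 + ∑ i, z i ^ 2))) =
        s ^ 2 * (t ^ 2 + g ^ 2 + ∑ i, z i ^ 2) := by
      field_simp
      ring
    have h2 : t ^ 2 * (t⁻¹ ^ 2 * g ^ 2) = g ^ 2 := by field_simp
    rw [h1, h2]
    constructor <;> intro h <;> nlinarith
  constructor
  · rintro ⟨⟨ht, hS, hW⟩, hr⟩
    exact ⟨⟨ht, hS⟩, hr, (key ht).1 hW⟩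
  · rintro ⟨⟨ht, hS⟩, hr, hW⟩
    exact ⟨⟨ht, hS, (key ht).2 hW⟩, hr⟩

end

theorem measurableSet_gnomonicSlab {n : ℕ} (v : EuclideanSpace ℝ (Fin n)) (s : ℝ) :
    MeasurableSet {x : EuclideanSpace ℝ (Fin n) | ⟪x, v⟫ ^ 2 ≤ s ^ 2 * (1 + ‖x‖ ^ 2)} :=
  measurableSet_le (by fun_prop) (by fun_prop)

theorem setLIntegral_cauchyDensity_slab_compl_mul_le {m : ℕ}
    {S : Set (EuclideanSpace ℝ (Fin (m + 1)))} (hS : MeasurableSet S) (hconv : Convex ℝ S)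
    (hsymm : ∀ x ∈ S, -x ∈ S) {v : EuclideanSpace ℝ (Fin (m + 1))} (hv : ‖v‖ = 1) {s : ℝ}
    (hs : 0 < s) :
    (∫⁻ x in S ∩ {x | ⟪x, v⟫ ^ 2 ≤ s ^ 2 * (1 + ‖x‖ ^ 2)}ᶜ,
        ENNReal.ofReal (cauchyDensity (m + 1) x)) *
        (∫⁻ x, ENNReal.ofReal (cauchyDensity (m + 1) x)) ≤
      (∫⁻ x in S, ENNReal.ofReal (cauchyDensity (m + 1) x)) *
        ∫⁻ x in {x | ⟪x, v⟫ ^ 2 ≤ s ^ 2 * (1 + ‖x‖ ^ 2)}ᶜ,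
          ENNReal.ofReal (cauchyDensity (m + 1) x) := by
  obtain ⟨φ, hφ, hinner, hnorm⟩ := exists_measurePreserving_coord m v hv
  have hW := (measurableSet_gnomonicSlab v s).compl
  have key := (isReflCone_coneOver hφ.measurable hS hconv hsymm).lintegral_volume_coneBall_mul_le
    ((1 - s ^ 2) / s ^ 2)
  simp only [← coneOver_univ (φ := φ), ← coneBall_coneOver_inter hinner hnorm hs] at key
  rw [Set.univ_inter] at key
  rw [← setLIntegral_univ (μ := volume) fun x => ENNReal.ofReal (cauchyDensity (m + 1) x),
    setLIntegral_cauchyDensity hφ hnorm (hS.inter hW), setLIntegral_cauchyDensity hφ hnorm hS,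
    setLIntegral_cauchyDensity hφ hnorm hW, setLIntegral_cauchyDensity hφ hnorm .univ,
    
    mul_mul_mul_comm (ENNReal.ofReal ((m + 1 : ℕ) + 1)) _ (ENNReal.ofReal ((m + 1 : ℕ) + 1)),
    mul_mul_mul_comm (ENNReal.ofReal ((m + 1 : ℕ) + 1)) _ (ENNReal.ofReal ((m + 1 : ℕ) + 1))]
  exact mul_le_mul_right key _

theorem cauchyDensity_nonneg (n : ℕ) (x : EuclideanSpace ℝ (Fin n)) : 0 ≤ cauchyDensity n x := by
  unfold cauchyDensity
  positivity

theorem cauchyConst_nonneg (n : ℕ) : 0 ≤ cauchyConst n :=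
  inv_nonneg.2 (integral_nonneg (cauchyDensity_nonneg n))

theorem cauchyMeasure_apply {n : ℕ} {S : Set (EuclideanSpace ℝ (Fin n))} (hS : MeasurableSet S) :
    cauchyMeasure n S =
      ENNReal.ofReal (cauchyConst n) * ∫⁻ x in S, ENNReal.ofReal (cauchyDensity n x) := by
  rw [cauchyMeasure, withDensity_apply _ hS, ← lintegral_const_mul' _ _ ENNReal.ofReal_ne_top]
  simp only [ENNReal.ofReal_mul (cauchyConst_nonneg n)]

theorem cauchyMeasure_univ {n : ℕ} (h : cauchyConst n ≠ 0) : cauchyMeasure n Set.univ = 1 := by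
  have h0 : ∫ x, cauchyDensity n x ≠ 0 := fun h' => h (by rw [cauchyConst, h', inv_zero])
  have hint : Integrable (cauchyDensity n) := by
    by_contra hc
    exact h0 (integral_undef hc)
  rw [cauchyMeasure_apply .univ, setLIntegral_univ,
    ← ofReal_integral_eq_lintegral_ofReal hint (.of_forall (cauchyDensity_nonneg n)),
    ← ENNReal.ofReal_mul (cauchyConst_nonneg n), cauchyConst, inv_mul_cancel₀ h0,
    ENNReal.ofReal_one]

theorem measure_mul_le_inter_of_inter_compl_le {α : Type*} [MeasurableSpace α] {μ : Measure α}
    [IsProbabilityMeasure μ] {A W : Set α} (hW : MeasurableSet W)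
    (h : μ (A ∩ Wᶜ) ≤ μ A * μ Wᶜ) : μ A * μ W ≤ μ (A ∩ W) := by
  have h1 : μ A * μ W + μ A * μ Wᶜ = μ (A ∩ W) + μ (A ∩ Wᶜ) := by
    rw [← mul_add, measure_add_measure_compl hW, measure_univ, mul_one, ← Set.sdiff_eq,
      measure_inter_add_sdiff A hW]
  have h2 : μ A * μ W + μ A * μ Wᶜ ≤ μ (A ∩ W) + μ A * μ Wᶜ := h1.trans_le (by gcongr)
  exact (ENNReal.add_le_add_iff_right
    (ENNReal.mul_ne_top (measure_ne_top μ _) (measure_ne_top μ _))).1 h2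

/-- Cauchy correlation with a gnomonic slab: for a bounded symmetric convex
set `M` and the gnomonic preimage `W = {x : ⟨x,v⟩² ≤ sin²(ε)·(1+|x|²)}` of the `ε`-tube
around a great hypersphere through the pole, `ν_n(M ∩ W) ≥ ν_n(M)·ν_n(W)`. -/
theorem cauchy_correlation_gnomonic_slab (n : ℕ) (hn : 1 ≤ n)
    (M : Set (EuclideanSpace ℝ (Fin n))) (hMconv : Convex ℝ M) (hMsym : M = -M)
    (hMbdd : Bornology.IsBounded M) (hMint : (interior M).Nonempty)
    (v : EuclideanSpace ℝ (Fin n)) (hv : ‖v‖ = 1)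
    (ε : ℝ) (hε : ε ∈ Set.Ioc 0 (π / 2)) :
    cauchyMeasure n (M ∩ {x | ⟪x, v⟫ ^ 2 ≤ Real.sin ε ^ 2 * (1 + ‖x‖ ^ 2)}) ≥
      cauchyMeasure n M *
        cauchyMeasure n {x | ⟪x, v⟫ ^ 2 ≤ Real.sin ε ^ 2 * (1 + ‖x‖ ^ 2)} := by
  obtain ⟨m, rfl⟩ : ∃ m, n = m + 1 := ⟨n - 1, by omega⟩
  rcases eq_or_ne (cauchyConst (m + 1)) 0 with hc | hc
  · simp [cauchyMeasure, hc]
  have hprob : IsProbabilityMeasure (cauchyMeasure (m + 1)) := ⟨cauchyMeasure_univ hc⟩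
  have hs : 0 < Real.sin ε := Real.sin_pos_of_pos_of_lt_pi hε.1 (by linarith [hε.2, Real.pi_pos])
  have hW := measurableSet_gnomonicSlab v (Real.sin ε)
  have hae : (interior M : Set _) =ᵐ[cauchyMeasure (m + 1)] M :=
    (withDensity_absolutelyContinuous volume _).ae_eq
      (interior_ae_eq_of_null_frontier (hMconv.addHaar_frontier volume))
  have hae' : (interior M ∩ {x | ⟪x, v⟫ ^ 2 ≤ Real.sin ε ^ 2 * (1 + ‖x‖ ^ 2)} : Set _)
      =ᵐ[cauchyMeasure (m + 1)] (M ∩ {x | ⟪x, v⟫ ^ 2 ≤ Real.sin ε ^ 2 * (1 + ‖x‖ ^ 2)} : Set _) :=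
    hae.inter (ae_eq_refl _)
  rw [ge_iff_le, ← measure_congr hae, ← measure_congr hae']
  refine measure_mul_le_inter_of_inter_compl_le hW ?_
  have hsymm : ∀ x ∈ interior M, -x ∈ interior M := by
    intro x hx
    refine interior_maximal (fun y hy => ?_) (isOpen_interior.preimage continuous_neg)
      (show - -x ∈ interior M by rwa [neg_neg])
    rw [hMsym]
    exact interior_subset (s := M) hy
  have hM : MeasurableSet (interior M) := isOpen_interior.measurableSet
  have key := setLIntegral_cauchyDensity_slab_compl_mul_le hM hMconv.interior hsymm hv hs
  have huniv := measure_univ (μ := cauchyMeasure (m + 1))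
  rw [cauchyMeasure_apply .univ, setLIntegral_univ] at huniv
  rw [← mul_one (cauchyMeasure (m + 1) _), ← huniv, cauchyMeasure_apply (hM.inter hW.compl),
    cauchyMeasure_apply hM, cauchyMeasure_apply hW.compl,
    mul_mul_mul_comm (ENNReal.ofReal (cauchyConst (m + 1))) _ (ENNReal.ofReal (cauchyConst (m + 1))),
    mul_mul_mul_comm (ENNReal.ofReal (cauchyConst (m + 1))) _ (ENNReal.ofReal (cauchyConst (m + 1)))]
  exact mul_le_mul_right key _
end

section
/- Spherical correlation inequality when one set is a geodesic ball centered at the pole: let K₀ ⊆ ℝ^n be a convex set with 0 ∈ K₀, let K = q(K₀) ⊆ S^n_+ be its gnomonic image, and let r ∈ (0, π/2]. Then μ_n(K ∩ B_S(o, r))·μ_n(S^n_+) ≥ μ_n(K)·μ_n(B_S(o, r)). -/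
open MeasureTheory Real
open scoped RealInnerProductSpace ENNReal

/-- Closed geodesic ball on the unit sphere: `B_S(p, r) = {y ∈ Sⁿ : ⟪y, p⟫ ≥ cos r}`. -/
noncomputable def geodesicBall (n : ℕ) (p : EuclideanSpace ℝ (Fin (n + 1))) (r : ℝ) :
    Set (EuclideanSpace ℝ (Fin (n + 1))) :=
  {y ∈ unitSphereSet n | Real.cos r ≤ ⟪y, p⟫}
/-- The characteristic function of a rotation-invariant measure is radial. -/
lemma charFun_eq_of_norm_eq {E : Type*} [NormedAddCommGroup E] [InnerProductSpace ℝ E]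
    [FiniteDimensional ℝ E] [MeasurableSpace E] [BorelSpace E] {m : Measure E}
    (hm : ∀ g : E ≃ₗᵢ[ℝ] E, m.map g = m) {s t : E} (hst : ‖s‖ = ‖t‖) :
    charFun m s = charFun m t := by
  set g : E ≃ₗᵢ[ℝ] E := (ℝ ∙ (s - t))ᗮ.reflection with hg
  have hgs : g s = t := Submodule.reflection_sub hst
  conv_rhs => rw [← hm g]
  rw [charFun_apply, charFun_apply, integral_map (by fun_prop) (by fun_prop)]
  simp [← hgs]

/-- Finite rotation-invariant measures carried by the unit sphere are proportional. -/
lemma smul_eq_smul_of_map_isometry_eq {E : Type*} [NormedAddCommGroup E] [InnerProductSpace ℝ E]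
    [FiniteDimensional ℝ E] [MeasurableSpace E] [BorelSpace E] (m₁ m₂ : Measure E)
    [IsFiniteMeasure m₁] [IsFiniteMeasure m₂]
    (h₁ : ∀ g : E ≃ₗᵢ[ℝ] E, m₁.map g = m₁) (h₂ : ∀ g : E ≃ₗᵢ[ℝ] E, m₂.map g = m₂)
    (hs₁ : ∀ᵐ x ∂m₁, ‖x‖ = 1) (hs₂ : ∀ᵐ x ∂m₂, ‖x‖ = 1) :
    m₂ Set.univ • m₁ = m₁ Set.univ • m₂ := by
  have f₁ : IsFiniteMeasure (m₂ Set.univ • m₁) := Measure.smul_finite _ (measure_ne_top _ _)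
  have f₂ : IsFiniteMeasure (m₁ Set.univ • m₂) := Measure.smul_finite _ (measure_ne_top _ _)
  have average : ∀ (μ ν : Measure E) [IsFiniteMeasure μ] [IsFiniteMeasure ν],
      (∀ g : E ≃ₗᵢ[ℝ] E, μ.map g = μ) → (∀ᵐ x ∂ν, ‖x‖ = 1) → ∀ t : E,
      ∫ x, charFun μ (‖t‖ • x) ∂ν = ν.real Set.univ • charFun μ t := by
    intro μ ν _ _ hμ hν t
    rw [← integral_const]
    refine integral_congr_ae ?_
    filter_upwards [hν] with x hx
    exact charFun_eq_of_norm_eq hμ (by simp [norm_smul, hx])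
  refine Measure.ext_of_charFun (funext fun t => ?_)
  rw [charFun_apply, charFun_apply, integral_smul_measure, integral_smul_measure,
    ← charFun_apply, ← charFun_apply]
  change m₂.real Set.univ • _ = m₁.real Set.univ • _
  rw [← average m₁ m₂ h₁ hs₂ t, ← average m₂ m₁ h₂ hs₁ t]
  simp only [charFun_apply]
  rw [integral_integral_swap]
  · refine integral_congr_ae (.of_forall fun y => integral_congr_ae (.of_forall fun x => ?_))
    simp only [inner_smul_right, real_inner_comm]
  · refine Integrable.of_bound (C := 1) (Continuous.aestronglyMeasurable ?_) (.of_forall ?_)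
    · simp only [Function.uncurry_def]; fun_prop
    · rintro ⟨x, y⟩
      simp only [Function.uncurry_apply_pair]
      rw [Complex.norm_exp_ofReal_mul_I]

/-- A star-shaped closed set is positively correlated with the centered balls, with respect to a
finite rotation-invariant measure without mass at the origin. -/
lemma measure_mul_measure_closedBall_le {E : Type*} [NormedAddCommGroup E] [InnerProductSpace ℝ E]
    [FiniteDimensional ℝ E] [MeasurableSpace E] [BorelSpace E] (ν : Measure E)
    [IsFiniteMeasure ν] (hν : ∀ g : E ≃ₗᵢ[ℝ] E, ν.map g = ν) (hν0 : ν {0} = 0)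
    {K : Set E} (hK : StarConvex ℝ 0 K) (hKc : IsClosed K) {R : ℝ} (hR : 0 < R) :
    ν K * ν (Metric.closedBall 0 R) ≤ ν (K ∩ Metric.closedBall 0 R) * ν Set.univ := by
  set B := Metric.closedBall (0 : E) R with hB
  have hBm : MeasurableSet B := Metric.isClosed_closedBall.measurableSet
  set p : E → E := fun x => ‖x‖⁻¹ • x with hp
  have hpm : Measurable p := by fun_prop
  have map_inv : ∀ A : Set E, MeasurableSet A → (∀ g : E ≃ₗᵢ[ℝ] E, g ⁻¹' A = A) →
      ∀ g : E ≃ₗᵢ[ℝ] E, ((ν.restrict A).map p).map g = (ν.restrict A).map p := by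
    intro A hA hgA g
    have hgm : Measurable g := g.continuous.measurable
    have : g ∘ p = p ∘ g := by ext x; simp [hp]
    rw [Measure.map_map hgm hpm, this, ← Measure.map_map hpm hgm]
    conv_lhs => rw [← hgA g]
    rw [← Measure.restrict_map hgm hA, hν g]
  have sphere : ∀ A : Set E, ∀ᵐ x ∂((ν.restrict A).map p), ‖x‖ = 1 := by
    intro A
    rw [ae_map_iff hpm.aemeasurable (measurableSet_eq_fun (by fun_prop) (by fun_prop))]
    refine ae_restrict_of_ae ?_
    have : ∀ᵐ x ∂ν, x ≠ 0 := by rw [ae_iff]; simpa using hν0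
    filter_upwards [this] with x hx
    simp [hp, norm_smul, hx]
  have hgB : ∀ g : E ≃ₗᵢ[ℝ] E, g ⁻¹' B = B := fun g => by ext x; simp [hB]
  have key := smul_eq_smul_of_map_isometry_eq ((ν.restrict B).map p) ((ν.restrict Bᶜ).map p)
    (map_inv B hBm hgB) (map_inv Bᶜ hBm.compl fun g => by rw [Set.preimage_compl, hgB])
    (sphere B) (sphere Bᶜ)
  set C : Set E := {u | R • u ∈ K} with hC
  have hCm : MeasurableSet C := (hKc.preimage (continuous_const_smul R)).measurableSet
  have key' := congrArg (fun m => m C) key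
  simp only [Measure.smul_apply, smul_eq_mul, Measure.map_apply hpm hCm,
    Measure.map_apply hpm MeasurableSet.univ, Set.preimage_univ,
    Measure.restrict_apply MeasurableSet.univ, Set.univ_inter,
    Measure.restrict_apply (hpm hCm)] at key'
  have inner_le : ν (p ⁻¹' C ∩ B) ≤ ν (K ∩ B) := by
    refine measure_mono_ae ?_
    have : ∀ᵐ x ∂ν, x ≠ 0 := by rw [ae_iff]; simpa using hν0
    filter_upwards [this] with x hx hxC
    refine ⟨?_, hxC.2⟩
    have hxR : ‖x‖ ≤ R := by simpa [hB] using hxC.2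
    have hpos : 0 < ‖x‖ := norm_pos_iff.2 hx
    have h := hK.smul_mem (show R • (‖x‖⁻¹ • x) ∈ K from hxC.1) (t := ‖x‖ / R) (by positivity)
      ((div_le_one hR).2 hxR)
    rwa [smul_smul, smul_smul, show ‖x‖ / R * R * ‖x‖⁻¹ = 1 by field_simp, one_smul] at h
  have outer_le : ν (K ∩ Bᶜ) ≤ ν (p ⁻¹' C ∩ Bᶜ) := by
    refine measure_mono fun x hx => ⟨?_, hx.2⟩
    have hxR : R < ‖x‖ := by simpa [hB] using hx.2
    have hpos : 0 < ‖x‖ := hR.trans hxR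
    have h := hK.smul_mem hx.1 (t := R / ‖x‖) (by positivity) ((div_le_one hpos).2 hxR.le)
    change R • (‖x‖⁻¹ • x) ∈ K
    rwa [smul_smul, ← div_eq_mul_inv]
  have hcross : ν (K ∩ Bᶜ) * ν B ≤ ν (K ∩ B) * ν Bᶜ :=
    calc ν (K ∩ Bᶜ) * ν B ≤ ν (p ⁻¹' C ∩ Bᶜ) * ν B := by gcongr
      _ = ν (p ⁻¹' C ∩ B) * ν Bᶜ := by rw [mul_comm, ← key', mul_comm]
      _ ≤ ν (K ∩ B) * ν Bᶜ := by gcongr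
  rw [← measure_inter_add_sdiff K hBm, ← measure_add_measure_compl hBm, Set.sdiff_eq, add_mul,
    mul_add]
  gcongr

lemma gnomonic_castSucc (n : ℕ) (x : EuclideanSpace ℝ (Fin n)) (i : Fin n) :
    gnomonic n x i.castSucc = (√(1 + ‖x‖ ^ 2))⁻¹ * x i := by
  simp [gnomonic, EuclideanSpace.equiv]

lemma gnomonic_last (n : ℕ) (x : EuclideanSpace ℝ (Fin n)) :
    gnomonic n x (Fin.last n) = (√(1 + ‖x‖ ^ 2))⁻¹ := by
  simp [gnomonic, EuclideanSpace.equiv]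

lemma inner_pole (n : ℕ) (y : EuclideanSpace ℝ (Fin (n + 1))) :
    ⟪y, pole n⟫ = y (Fin.last n) := by
  simp [pole, EuclideanSpace.inner_single_right]

lemma norm_pole (n : ℕ) : ‖pole n‖ = 1 := by
  simp [pole]

lemma inner_gnomonic_gnomonic (n : ℕ) (x y : EuclideanSpace ℝ (Fin n)) :
    ⟪gnomonic n x, gnomonic n y⟫ =
      (√(1 + ‖x‖ ^ 2))⁻¹ * (√(1 + ‖y‖ ^ 2))⁻¹ * (⟪x, y⟫ + 1) := by
  simp only [PiLp.inner_apply, RCLike.inner_apply, conj_trivial]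
  rw [Fin.sum_univ_castSucc]
  simp only [gnomonic_castSucc, gnomonic_last]
  rw [mul_add, Finset.mul_sum]
  congr 1
  · exact Finset.sum_congr rfl fun i _ => by ring
  · ring

lemma norm_gnomonic (n : ℕ) (x : EuclideanSpace ℝ (Fin n)) : ‖gnomonic n x‖ = 1 := by
  have h := inner_gnomonic_gnomonic n x x
  have hp : 0 < 1 + ‖x‖ ^ 2 := by positivity
  rw [real_inner_self_eq_norm_sq, real_inner_self_eq_norm_sq, ← mul_inv,
    Real.mul_self_sqrt hp.le, add_comm (‖x‖ ^ 2), inv_mul_cancel₀ hp.ne'] at h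
  exact (pow_eq_one_iff_of_nonneg (norm_nonneg _) two_ne_zero).1 h

lemma dist_gnomonic_sq (n : ℕ) (x y : EuclideanSpace ℝ (Fin n)) :
    dist (gnomonic n x) (gnomonic n y) ^ 2 =
      2 - 2 * ((√(1 + ‖x‖ ^ 2))⁻¹ * (√(1 + ‖y‖ ^ 2))⁻¹ * (⟪x, y⟫ + 1)) := by
  rw [dist_eq_norm, norm_sub_sq_real, norm_gnomonic, norm_gnomonic, inner_gnomonic_gnomonic]
  ring

lemma lipschitzWith_gnomonic (n : ℕ) : LipschitzWith 1 (gnomonic n) := by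
  refine LipschitzWith.mk_one fun x y => ?_
  refine le_of_sq_le_sq ?_ dist_nonneg
  rw [dist_gnomonic_sq, dist_eq_norm, norm_sub_sq_real]
  have hx : 0 ≤ 1 + ‖x‖ ^ 2 := by positivity
  have hy : 0 ≤ 1 + ‖y‖ ^ 2 := by positivity
  have ha := Real.sq_sqrt hx
  have hb := Real.sq_sqrt hy
  have ha1 : 1 ≤ √(1 + ‖x‖ ^ 2) := Real.one_le_sqrt.2 (by nlinarith [sq_nonneg ‖x‖])
  have hb1 : 1 ≤ √(1 + ‖y‖ ^ 2) := Real.one_le_sqrt.2 (by nlinarith [sq_nonneg ‖y‖])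
  have hc : ⟪x, y⟫ + 1 ≤ √(1 + ‖x‖ ^ 2) * √(1 + ‖y‖ ^ 2) := by
    rw [← Real.sqrt_mul hx]
    refine Real.le_sqrt_of_sq_le ?_
    have h1 := abs_real_inner_le_norm x y
    have h2 : ⟪x, y⟫ ^ 2 ≤ (‖x‖ * ‖y‖) ^ 2 := sq_le_sq' (abs_le.1 h1).1 (abs_le.1 h1).2
    nlinarith [sq_nonneg (‖x‖ - ‖y‖), (abs_le.1 h1).2]
  set a := √(1 + ‖x‖ ^ 2)
  set b := √(1 + ‖y‖ ^ 2)
  have hab : 1 ≤ a * b := by nlinarith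
  have hinv : (a * b)⁻¹ ≤ 1 := inv_le_one_of_one_le₀ hab
  have hone : (a * b)⁻¹ * (a * b) = 1 := inv_mul_cancel₀ (by positivity)
  rw [← mul_inv]
  nlinarith [sq_nonneg (a - b), mul_nonneg (sub_nonneg.2 hc) (sub_nonneg.2 hinv)]

lemma gnomonic_injective (n : ℕ) : Function.Injective (gnomonic n) := by
  intro x y h
  have hl : (√(1 + ‖x‖ ^ 2))⁻¹ = (√(1 + ‖y‖ ^ 2))⁻¹ := by
    rw [← gnomonic_last, ← gnomonic_last, h]
  have hne : (√(1 + ‖y‖ ^ 2))⁻¹ ≠ 0 := by positivity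
  ext i
  have hi : gnomonic n x i.castSucc = gnomonic n y i.castSucc := by rw [h]
  rw [gnomonic_castSucc, gnomonic_castSucc, hl] at hi
  exact mul_left_cancel₀ hne hi

lemma measurableEmbedding_gnomonic (n : ℕ) : MeasurableEmbedding (gnomonic n) :=
  (lipschitzWith_gnomonic n).continuous.measurableEmbedding (gnomonic_injective n)

lemma range_gnomonic (n : ℕ) : Set.range (gnomonic n) = hemisphere n := by
  ext y
  simp only [hemisphere, unitSphereSet, Set.mem_ofPred_eq, mem_sphere_zero_iff_norm, inner_pole]
  constructor
  · rintro ⟨x, rfl⟩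
    exact ⟨norm_gnomonic n x, by rw [gnomonic_last]; positivity⟩
  · rintro ⟨hy, hpos⟩
    refine ⟨WithLp.toLp 2 fun i => y i.castSucc / y (Fin.last n), ?_⟩
    set x : EuclideanSpace ℝ (Fin n) := WithLp.toLp 2 fun i => y i.castSucc / y (Fin.last n)
      with hx
    have hsum : 1 + ‖x‖ ^ 2 = (y (Fin.last n))⁻¹ ^ 2 := by
      have h1 : ‖y‖ ^ 2 = 1 := by rw [hy, one_pow]
      rw [EuclideanSpace.real_norm_sq_eq, Fin.sum_univ_castSucc] at h1
      rw [EuclideanSpace.real_norm_sq_eq]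
      simp only [hx, div_pow]
      rw [← Finset.sum_div]
      field_simp
      linarith
    have hsqrt : (√(1 + ‖x‖ ^ 2))⁻¹ = y (Fin.last n) := by
      rw [hsum, Real.sqrt_sq (by positivity), inv_inv]
    ext i
    refine Fin.lastCases ?_ (fun i => ?_) i
    · rw [gnomonic_last, hsqrt]
    · rw [gnomonic_castSucc, hsqrt]
      simp only [hx]
      field_simp

/-- Rotating by a linear isometry before the gnomonic projection does not change the Hausdorff
measure of the image. -/
lemma hausdorffMeasure_gnomonic_image_isometry (n : ℕ) {d : ℝ} (hd : 0 ≤ d)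
    (g : EuclideanSpace ℝ (Fin n) ≃ₗᵢ[ℝ] EuclideanSpace ℝ (Fin n))
    (A : Set (EuclideanSpace ℝ (Fin n))) :
    μH[d] (gnomonic n '' (g '' A)) = μH[d] (gnomonic n '' A) := by
  have le : ∀ (g : EuclideanSpace ℝ (Fin n) ≃ₗᵢ[ℝ] EuclideanSpace ℝ (Fin n))
      (A : Set (EuclideanSpace ℝ (Fin n))),
      μH[d] (gnomonic n '' (g '' A)) ≤ μH[d] (gnomonic n '' A) := by
    intro g A
    set f := gnomonic n ∘ g ∘ Function.invFun (gnomonic n) with hf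
    have hfq : ∀ x, f (gnomonic n x) = gnomonic n (g x) := fun x => by
      simp [hf, Function.leftInverse_invFun (gnomonic_injective n) x]
    have hlip : LipschitzOnWith 1 f (gnomonic n '' A) := by
      refine LipschitzOnWith.of_dist_le_mul ?_
      rintro _ ⟨x, -, rfl⟩ _ ⟨y, -, rfl⟩
      rw [hfq, hfq, NNReal.coe_one, one_mul]
      refine le_of_sq_le_sq (le_of_eq ?_) dist_nonneg
      simp [dist_gnomonic_sq]
    have h := hlip.hausdorffMeasure_image_le hd
    rw [Set.image_image, Set.image_congr fun x _ => hfq x] at h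
    simpa [Set.image_image] using h
  refine (le g A).antisymm ?_
  simpa [Set.image_image] using le g.symm (g '' A)

/-- The `n`-dimensional Hausdorff measure of a gnomonic image is bounded by that of the set. -/
lemma hausdorffMeasure_gnomonic_image_le (n : ℕ) (A : Set (EuclideanSpace ℝ (Fin n))) :
    μH[(n : ℝ)] (gnomonic n '' A) ≤ μH[(n : ℝ)] A := by
  simpa using (lipschitzWith_gnomonic n).hausdorffMeasure_image_le (Nat.cast_nonneg n) A

lemma isAddHaarMeasure_hausdorffMeasure_euclideanSpace (n : ℕ) :
    (μH[(n : ℝ)] : Measure (EuclideanSpace ℝ (Fin n))).IsAddHaarMeasure := by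
  have e : (n : ℝ) = Module.finrank ℝ (EuclideanSpace ℝ (Fin n)) := by
    rw [finrank_euclideanSpace_fin]
  rw [e]
  exact isAddHaarMeasure_hausdorffMeasure

/-- A linear isometry exchanging a given unit vector with the pole. -/
lemma exists_isometry_swap_pole (n : ℕ) {p : EuclideanSpace ℝ (Fin (n + 1))} (hp : ‖p‖ = 1) :
    ∃ g : EuclideanSpace ℝ (Fin (n + 1)) ≃ₗᵢ[ℝ] EuclideanSpace ℝ (Fin (n + 1)),
      g p = pole n ∧ g (pole n) = p := by
  have h : (ℝ ∙ (p - pole n))ᗮ.reflection p = pole n :=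
    Submodule.reflection_sub (hp.trans (norm_pole n).symm)
  refine ⟨(ℝ ∙ (p - pole n))ᗮ.reflection, h, ?_⟩
  have h' := congrArg (ℝ ∙ (p - pole n))ᗮ.reflection h
  rw [Submodule.reflection_reflection] at h'
  exact h'.symm

lemma mem_geodesicBall_gnomonic_iff (n : ℕ) {r : ℝ} (hr0 : 0 < r) (hr : r < π / 2)
    (x : EuclideanSpace ℝ (Fin n)) :
    gnomonic n x ∈ geodesicBall n (pole n) r ↔ ‖x‖ ≤ tan r := by
  have hcos : 0 < cos r := cos_pos_of_mem_Ioo ⟨by linarith [pi_pos], hr⟩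
  have htan : 0 < tan r := tan_pos_of_pos_of_lt_pi_div_two hr0 hr
  simp only [geodesicBall, unitSphereSet, Set.mem_ofPred_eq, mem_sphere_zero_iff_norm,
    norm_gnomonic, true_and, inner_pole, gnomonic_last]
  rw [← inv_sqrt_one_add_tan_sq hcos, inv_le_inv₀ (by positivity) (by positivity),
    Real.sqrt_le_sqrt_iff (by positivity), add_le_add_iff_left,
    pow_le_pow_iff_left₀ (norm_nonneg _) htan.le two_ne_zero]

lemma hausdorffMeasure_unitSphereSet_lt_top (n : ℕ) : μH[(n : ℝ)] (unitSphereSet n) < ∞ := by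
  refine (isCompact_sphere _ _).measure_lt_top_of_nhdsWithin fun p hp => ?_
  have hp1 : ‖p‖ = 1 := by simpa using hp
  obtain ⟨g, hgp, -⟩ := exists_isometry_swap_pole n hp1
  set U : Set (EuclideanSpace ℝ (Fin (n + 1))) := {y | 2⁻¹ < ⟪y, p⟫} with hU
  have hUo : IsOpen U := isOpen_lt continuous_const (by fun_prop)
  refine ⟨U ∩ Metric.sphere 0 1, Filter.inter_mem
    (mem_nhdsWithin_of_mem_nhds (hUo.mem_nhds ?_)) self_mem_nhdsWithin, ?_⟩
  · simp only [hU, Set.mem_ofPred_eq, real_inner_self_eq_norm_sq, hp1]; norm_num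
  · have hsub : g '' (U ∩ Metric.sphere 0 1) ⊆ gnomonic n '' Metric.closedBall 0 2 := by
      rintro _ ⟨y, ⟨hy, hy1⟩, rfl⟩
      have hin : 2⁻¹ < ⟪g y, pole n⟫ := by rw [← hgp, g.inner_map_map]; exact hy
      have hmem : g y ∈ Set.range (gnomonic n) := by
        rw [range_gnomonic]
        exact ⟨by simpa [unitSphereSet] using hy1, by linarith⟩
      obtain ⟨x, hx⟩ := hmem
      refine ⟨x, ?_, hx⟩
      rw [← hx, inner_pole, gnomonic_last, inv_lt_inv₀ (by norm_num) (by positivity),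
        Real.sqrt_lt (by positivity) (by norm_num)] at hin
      rw [mem_closedBall_zero_iff]
      nlinarith [norm_nonneg x]
    have := isAddHaarMeasure_hausdorffMeasure_euclideanSpace n
    rw [← g.isometry.hausdorffMeasure_image (.inl (Nat.cast_nonneg n))]
    exact ((measure_mono hsub).trans (hausdorffMeasure_gnomonic_image_le n _)).trans_lt
      (isCompact_closedBall _ _).measure_lt_top

lemma hausdorffMeasure_equator (n : ℕ) :
    μH[(n : ℝ)] {y ∈ unitSphereSet n | ⟪y, pole n⟫ = 0} = 0 := by
  refine measure_null_of_locally_null _ fun p ⟨hp, hp0⟩ => ?_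
  have hp1 : ‖p‖ = 1 := by simpa [unitSphereSet] using hp
  obtain ⟨g, hgp, hgo⟩ := exists_isometry_swap_pole n hp1
  set U : Set (EuclideanSpace ℝ (Fin (n + 1))) := {y | 0 < ⟪y, p⟫} with hU
  have hUo : IsOpen U := isOpen_lt continuous_const (by fun_prop)
  refine ⟨U ∩ {y ∈ unitSphereSet n | ⟪y, pole n⟫ = 0}, Filter.inter_mem
    (mem_nhdsWithin_of_mem_nhds (hUo.mem_nhds ?_)) self_mem_nhdsWithin, ?_⟩
  · simp [hU, hp1]
  set v : EuclideanSpace ℝ (Fin n) := WithLp.toLp 2 fun i => p i.castSucc with hv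
  have hlast : p (Fin.last n) = 0 := by rw [← inner_pole]; exact hp0
  have hv0 : v ≠ 0 := by
    intro h
    have : p = 0 := by
      ext i
      refine Fin.lastCases hlast (fun i => ?_) i
      simpa [hv] using congrArg (fun w : EuclideanSpace ℝ (Fin n) => w i) h
    simp [this] at hp1
  have hsub : g '' (U ∩ {y ∈ unitSphereSet n | ⟪y, pole n⟫ = 0}) ⊆
      gnomonic n '' ((ℝ ∙ v)ᗮ : Submodule ℝ (EuclideanSpace ℝ (Fin n))) := by
    rintro _ ⟨y, ⟨hy, hy1, hy0⟩, rfl⟩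
    have hin : 0 < ⟪g y, pole n⟫ := by rw [← hgp, g.inner_map_map]; exact hy
    have hmem : g y ∈ Set.range (gnomonic n) := by
      rw [range_gnomonic]
      exact ⟨by simpa [unitSphereSet] using hy1, hin⟩
    obtain ⟨x, hx⟩ := hmem
    refine ⟨x, ?_, hx⟩
    have hperp : ⟪gnomonic n x, p⟫ = 0 := by rw [hx, ← hgo, g.inner_map_map, hy0]
    have hinner : ⟪gnomonic n x, p⟫ = (√(1 + ‖x‖ ^ 2))⁻¹ * ⟪v, x⟫ := by
      simp only [PiLp.inner_apply, RCLike.inner_apply, conj_trivial]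
      rw [Fin.sum_univ_castSucc, hlast, zero_mul, add_zero, Finset.mul_sum]
      refine Finset.sum_congr rfl fun i _ => ?_
      rw [gnomonic_castSucc, hv]
      ring
    rw [hinner] at hperp
    exact Submodule.mem_orthogonal_singleton_iff_inner_right.2
      ((mul_eq_zero.1 hperp).resolve_left (by positivity))
  have := isAddHaarMeasure_hausdorffMeasure_euclideanSpace n
  rw [← g.isometry.hausdorffMeasure_image (.inl (Nat.cast_nonneg n))]
  refine measure_mono_null hsub (le_antisymm ((hausdorffMeasure_gnomonic_image_le n _).trans ?_)
    zero_le)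
  rw [Measure.addHaar_submodule]
  rw [Ne, Submodule.orthogonal_eq_top_iff, Submodule.span_singleton_eq_bot]
  exact hv0

/-- Spherical correlation inequality when one set is a geodesic ball
centered at the pole: for the gnomonic image `K = q(K₀)` of a convex set containing the
origin and `r ∈ (0, π/2]`,
`μ_n(K ∩ B_S(o,r)) · μ_n(Sⁿ₊) ≥ μ_n(K) · μ_n(B_S(o,r))`. -/
theorem spherical_correlation_ball (n : ℕ) (hn : 1 ≤ n)
    (K₀ : Set (EuclideanSpace ℝ (Fin n))) (hK₀ : Convex ℝ K₀) (h0K₀ : (0 : _) ∈ K₀)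
    (r : ℝ) (hr : r ∈ Set.Ioc 0 (π / 2)) :
    μH[(n : ℝ)] ((gnomonic n '' K₀) ∩ geodesicBall n (pole n) r) *
        μH[(n : ℝ)] (hemisphere n) ≥
      μH[(n : ℝ)] (gnomonic n '' K₀) * μH[(n : ℝ)] (geodesicBall n (pole n) r) := by
  obtain ⟨hr0, hr2⟩ := hr
  rcases hr2.lt_or_eq with hlt | rfl
  · have hHaar := isAddHaarMeasure_hausdorffMeasure_euclideanSpace n
    have hemb := measurableEmbedding_gnomonic n
    set ν : Measure (EuclideanSpace ℝ (Fin n)) := (μH[(n : ℝ)]).comap (gnomonic n) with hν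
    have hνA : ∀ A, ν A = μH[(n : ℝ)] (gnomonic n '' A) := hemb.comap_apply _
    have hν_null : ∀ A : Set (EuclideanSpace ℝ (Fin n)), μH[(n : ℝ)] A = 0 → ν A = 0 :=
      fun A hA => by
        rw [hνA]
        exact le_antisymm ((hausdorffMeasure_gnomonic_image_le n A).trans hA.le) zero_le
    have hfin : IsFiniteMeasure ν := ⟨by
      rw [hνA, Set.image_univ, range_gnomonic]
      exact (measure_mono fun y hy => hy.1).trans_lt (hausdorffMeasure_unitSphereSet_lt_top n)⟩
    have hinv : ∀ g : EuclideanSpace ℝ (Fin n) ≃ₗᵢ[ℝ] EuclideanSpace ℝ (Fin n),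
        ν.map g = ν := fun g => Measure.ext fun A hA => by
      rw [Measure.map_apply g.continuous.measurable hA, hνA, hνA,
        ← hausdorffMeasure_gnomonic_image_isometry n (Nat.cast_nonneg n) g (g ⁻¹' A),
        Set.image_preimage_eq _ g.surjective]
    have : Nonempty (Fin n) := ⟨⟨0, hn⟩⟩
    have hν0 : ν {0} = 0 := hν_null _ (measure_singleton _)
    have hball : geodesicBall n (pole n) r = gnomonic n '' Metric.closedBall 0 (tan r) := by
      ext y
      constructor
      · intro hy
        have hcos : 0 < cos r := cos_pos_of_mem_Ioo ⟨by linarith [pi_pos], hlt⟩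
        have hmem : y ∈ Set.range (gnomonic n) := by
          rw [range_gnomonic]
          exact ⟨hy.1, hcos.trans_le hy.2⟩
        obtain ⟨x, rfl⟩ := hmem
        exact ⟨x, by simpa using (mem_geodesicBall_gnomonic_iff n hr0 hlt x).1 hy, rfl⟩
      · rintro ⟨x, hx, rfl⟩
        exact (mem_geodesicBall_gnomonic_iff n hr0 hlt x).2 (by simpa using hx)
    have hclosure : ∀ B, ν (closure K₀ ∩ B) = ν (K₀ ∩ B) := by
      intro B
      refine le_antisymm ?_ (measure_mono (Set.inter_subset_inter_left _ subset_closure))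
      have hfr : ν (frontier K₀) = 0 := hν_null _ (hK₀.addHaar_frontier _)
      calc ν (closure K₀ ∩ B) ≤ ν ((K₀ ∩ B) ∪ frontier K₀) := measure_mono fun x hx => by
            by_cases hxK : x ∈ K₀
            · exact .inl ⟨hxK, hx.2⟩
            · exact .inr ⟨hx.1, fun h => hxK (interior_subset h)⟩
        _ ≤ ν (K₀ ∩ B) + ν (frontier K₀) := measure_union_le _ _
        _ = ν (K₀ ∩ B) := by rw [hfr, add_zero]
    have main := measure_mul_measure_closedBall_le ν hinv hν0
      (hK₀.closure.starConvex (subset_closure h0K₀)) isClosed_closure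
      (tan_pos_of_pos_of_lt_pi_div_two hr0 hlt)
    have hK := hclosure Set.univ
    rw [Set.inter_univ, Set.inter_univ] at hK
    rw [hclosure, hK] at main
    rw [hball, ← Set.image_inter (gnomonic_injective n), ← range_gnomonic, ← Set.image_univ,
      ← hνA, ← hνA, ← hνA, ← hνA]
    exact main
  · have hsub : hemisphere n ⊆ geodesicBall n (pole n) (π / 2) := fun y hy =>
      ⟨hy.1, by rw [cos_pi_div_two]; exact hy.2.le⟩
    have hK : gnomonic n '' K₀ ∩ geodesicBall n (pole n) (π / 2) = gnomonic n '' K₀ :=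
      Set.inter_eq_left.2 (((Set.image_subset_range _ _).trans (range_gnomonic n).le).trans hsub)
    rw [hK]
    refine mul_le_mul_right ?_ _
    calc μH[(n : ℝ)] (geodesicBall n (pole n) (π / 2))
        ≤ μH[(n : ℝ)] (hemisphere n ∪ {y ∈ unitSphereSet n | ⟪y, pole n⟫ = 0}) :=
          measure_mono fun y hy => by
            have h0 : 0 ≤ ⟪y, pole n⟫ := by simpa [cos_pi_div_two] using hy.2
            rcases h0.lt_or_eq with h | h
            · exact .inl ⟨hy.1, h⟩
            · exact .inr ⟨hy.1, h.symm⟩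
      _ ≤ μH[(n : ℝ)] (hemisphere n) + μH[(n : ℝ)] {y ∈ unitSphereSet n | ⟪y, pole n⟫ = 0} :=
          measure_union_le _ _
      _ = μH[(n : ℝ)] (hemisphere n) := by rw [hausdorffMeasure_equator, add_zero]
end
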